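/- arXiv:2101.06899 — 2 statements merged into one kernel-verified Lean document; each statement's English description precedes it below -/
import Mathlib

section
/- Let k ≥ 3 be a positive integer. If 2k + 1 is a prime, then there are infinitely many primes p such that the set [1,k] = {1,2,...,k} splits Z_p. -/
/-- `M` splits `ℤ_n`: there is a splitter set `S ⊆ ℤ_n` such that every nonzero
element of `ℤ_n` has a unique representation `m * s` with `m ∈ M`, `s ∈ S`,
while `0` has no such representation. -/
def Splits (M : Set ℤ) (n : ℕ) : Prop :=
  ∃ S : Set (ZMod n),
    (∀ g : ZMod n, g ≠ 0 → ∃! ms : ℤ × ZMod n,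
      ms.1 ∈ M ∧ ms.2 ∈ S ∧ (ms.1 : ZMod n) * ms.2 = g) ∧
    ¬ ∃ m ∈ M, ∃ s ∈ S, (m : ZMod n) * s = 0

section LogGrowth
open Filter Topology Asymptotics

/-- `Ψ` is bounded on the primes and `∑ₚ Ψ(p) p⁻ˢ = -c log (s - 1) + O(1)` as `s → 1⁺`. -/
def HasLogGrowth (Ψ : ℕ → ℝ) (c : ℝ) : Prop :=
  (∃ M, ∀ p : Nat.Primes, |Ψ p| ≤ M) ∧
    (fun s : ℝ ↦ ∑' p : Nat.Primes, Ψ p * (p : ℝ) ^ (-s) + c * Real.log (s - 1))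
      =O[𝓝[>] 1] (fun _ ↦ (1 : ℝ))

lemma summable_primes_of_bounded {Ψ : ℕ → ℝ} {M : ℝ} (hM : ∀ p : Nat.Primes, |Ψ p| ≤ M)
    {s : ℝ} (hs : 1 < s) : Summable fun p : Nat.Primes ↦ Ψ p * (p : ℝ) ^ (-s) := by
  refine Summable.of_norm_bounded
    (((Nat.Primes.summable_rpow (r := -s)).mpr (by linarith)).mul_left M) fun p ↦ ?_
  rw [norm_mul, Real.norm_eq_abs, Real.norm_of_nonneg (by positivity)]
  exact mul_le_mul_of_nonneg_right (hM p) (by positivity)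

namespace HasLogGrowth

variable {Ψ Φ : ℕ → ℝ} {c d : ℝ}

lemma add (h : HasLogGrowth Ψ c) (h' : HasLogGrowth Φ d) : HasLogGrowth (Ψ + Φ) (c + d) := by
  obtain ⟨⟨M, hM⟩, h⟩ := h
  obtain ⟨⟨M', hM'⟩, h'⟩ := h'
  refine ⟨⟨M + M', fun p ↦ (abs_add_le _ _).trans (add_le_add (hM p) (hM' p))⟩,
    (h.add h').congr' ?_ .rfl⟩
  filter_upwards [self_mem_nhdsWithin] with s hs
  have := (summable_primes_of_bounded hM hs).tsum_add (summable_primes_of_bounded hM' hs)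
  simp only [Pi.add_apply, add_mul, this]
  ring

lemma smul (r : ℝ) (h : HasLogGrowth Ψ c) : HasLogGrowth (r • Ψ) (r * c) := by
  obtain ⟨⟨M, hM⟩, h⟩ := h
  refine ⟨⟨|r| * M, fun p ↦ ?_⟩, (h.const_mul_left r).congr' ?_ .rfl⟩
  · rw [Pi.smul_apply, smul_eq_mul, abs_mul]
    exact mul_le_mul_of_nonneg_left (hM p) (abs_nonneg r)
  filter_upwards with s
  simp only [Pi.smul_apply, smul_eq_mul, mul_assoc, tsum_mul_left]
  ring

lemma zero : HasLogGrowth 0 0 := by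
  refine ⟨⟨0, by simp⟩, ?_⟩
  simpa using isBigO_zero (E' := ℝ) (fun _ : ℝ ↦ (1 : ℝ)) (𝓝[>] 1)

lemma of_finite_support {S : Set Nat.Primes} (hS : S.Finite) (h : ∀ p : Nat.Primes, p ∉ S → Ψ p = 0) :
    HasLogGrowth Ψ 0 := by
  have hb : ∀ p : Nat.Primes, |Ψ p| ≤ ∑ q ∈ hS.toFinset, |Ψ q| := fun p ↦ by
    by_cases hp : p ∈ S
    · exact Finset.single_le_sum (f := fun q : Nat.Primes ↦ |Ψ q|) (fun _ _ ↦ abs_nonneg _)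
        (hS.mem_toFinset.mpr hp)
    · rw [h p hp, abs_zero]
      exact Finset.sum_nonneg fun _ _ ↦ abs_nonneg _
  refine ⟨⟨_, hb⟩, IsBigO.of_bound (∑ q ∈ hS.toFinset, |Ψ q|) ?_⟩
  filter_upwards [self_mem_nhdsWithin] with s hs
  have hs : 1 < s := hs
  rw [tsum_eq_sum (s := hS.toFinset) (fun p hp ↦ by
    rw [h p (by simpa using hp), zero_mul]), zero_mul, add_zero, norm_one, mul_one]
  refine norm_sum_le_of_le _ fun p _ ↦ ?_
  rw [norm_mul, Real.norm_eq_abs, Real.norm_of_nonneg (by positivity)]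
  refine mul_le_of_le_one_right (abs_nonneg _)
    (Real.rpow_le_one_of_one_le_of_nonpos (by exact_mod_cast p.2.one_lt.le) (by linarith))

lemma congr_off_finite (h : HasLogGrowth Ψ c) {S : Set Nat.Primes} (hS : S.Finite)
    (hΦ : ∀ p : Nat.Primes, p ∉ S → Φ p = Ψ p) : HasLogGrowth Φ c := by
  have := h.add (of_finite_support (Ψ := Φ - Ψ) hS fun p hp ↦ by simp [hΦ p hp])
  simpa using this

lemma eq_zero (h : HasLogGrowth 0 c) : c = 0 := by
  by_contra hc
  have h1 := h.2
  simp only [Pi.zero_apply, zero_mul, tsum_zero, zero_add] at h1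
  have h2 : (fun s : ℝ ↦ Real.log (s - 1)) =O[𝓝[>] 1] (fun _ ↦ (1 : ℝ)) :=
    (h1.const_mul_left c⁻¹).congr_left fun s ↦ by field_simp
  have h3 : Tendsto (fun s : ℝ ↦ Real.log (s - 1)) (𝓝[>] 1) atBot := by
    refine Real.tendsto_log_nhdsGT_zero.comp ?_
    refine tendsto_nhdsWithin_iff.mpr ⟨?_, ?_⟩
    · have : Tendsto (fun s : ℝ ↦ s - 1) (𝓝 1) (𝓝 (1 - 1)) := by
        exact (continuous_id.sub continuous_const).tendsto 1
      rw [sub_self] at this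
      exact this.mono_left nhdsWithin_le_nhds
    · filter_upwards [self_mem_nhdsWithin] with s hs
      simpa using hs
  have h4 := tendsto_abs_atBot_atTop.comp h3
  obtain ⟨C, hC⟩ := h2.bound
  obtain ⟨s, hs1, hs2⟩ := (hC.and (h4.eventually_gt_atTop C)).exists
  simp at hs1 hs2
  linarith

end HasLogGrowth

lemma abs_log_one_add_sub_le {u R : ℝ} (hu : 0 ≤ u) (hR : 0 ≤ R) :
    |Real.log (1 + (u + R)) - u| ≤ (u + R) ^ 2 + R := by
  have hx : 0 ≤ u + R := by positivity
  have h1 := Real.log_le_sub_one_of_pos (x := 1 + (u + R)) (by linarith)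
  have h2 := Real.one_sub_inv_le_log_of_pos (x := 1 + (u + R)) (by linarith)
  have h3 : (1 + (u + R))⁻¹ ≤ 1 - (u + R) + (u + R) ^ 2 := by
    rw [inv_le_iff_one_le_mul₀ (by linarith)]
    nlinarith [pow_nonneg hx 3]
  rw [abs_le]
  constructor <;> nlinarith [sq_nonneg (u + R)]

lemma summable_add_three_pow_mul_half_pow (d : ℕ) :
    Summable fun e : ℕ ↦ ((e : ℝ) + 3) ^ d * (1 / 2 : ℝ) ^ e := by
  have h := (summable_nat_add_iff 3).mpr (summable_pow_mul_geometric_of_norm_lt_one d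
    (r := (1 / 2 : ℝ)) (by norm_num [Real.norm_eq_abs, abs_of_pos]))
  refine (h.mul_left 8).congr fun e ↦ ?_
  push_cast
  rw [pow_add]
  ring

lemma abs_log_tsum_sub_le {d : ℕ} {b : ℕ → ℝ} (h0 : b 0 = 1) (hb0 : ∀ e, 0 ≤ b e)
    (hb : ∀ e, b e ≤ ((e : ℝ) + 1) ^ d) {p : ℝ} (hp : 2 ≤ p) {s : ℝ} (hs : 1 < s) :
    0 < ∑' e : ℕ, b e * p ^ (-s * e) ∧
    |Real.log (∑' e : ℕ, b e * p ^ (-s * e)) - b 1 * p ^ (-s)| ≤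
      ((2 ^ d + ∑' e : ℕ, ((e : ℝ) + 3) ^ d * (1 / 2 : ℝ) ^ e) ^ 2 +
        ∑' e : ℕ, ((e : ℝ) + 3) ^ d * (1 / 2 : ℝ) ^ e) * p ^ (-2 : ℝ) := by
  set C := ∑' e : ℕ, ((e : ℝ) + 3) ^ d * (1 / 2 : ℝ) ^ e with hC
  have hp0 : 0 < p := by linarith
  have hC0 : 0 ≤ C := tsum_nonneg fun e ↦ by positivity
  have hterm : ∀ e : ℕ, b (e + 2) * p ^ (-s * ((e + 2 : ℕ) : ℝ)) ≤
      (((e : ℝ) + 3) ^ d * (1 / 2 : ℝ) ^ e) * p ^ (-2 : ℝ) := by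
    intro e
    have h1 : b (e + 2) ≤ ((e : ℝ) + 3) ^ d := by
      refine (hb _).trans (le_of_eq ?_)
      push_cast; ring
    have h2 : p ^ (-s * ((e + 2 : ℕ) : ℝ)) ≤ p ^ (-(e : ℝ) + (-2)) := by
      refine Real.rpow_le_rpow_of_exponent_le (by linarith) ?_
      push_cast
      nlinarith [(Nat.cast_nonneg e : (0 : ℝ) ≤ e)]
    have h3 : p ^ (-(e : ℝ)) ≤ (1 / 2 : ℝ) ^ e := by
      rw [Real.rpow_neg hp0.le, Real.rpow_natCast, ← inv_pow]
      refine pow_le_pow_left₀ (by positivity) ?_ _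
      rw [one_div]
      exact inv_anti₀ (by norm_num) hp
    rw [Real.rpow_add hp0] at h2
    calc b (e + 2) * p ^ (-s * ((e + 2 : ℕ) : ℝ))
        ≤ ((e : ℝ) + 3) ^ d * (p ^ (-(e : ℝ)) * p ^ (-2 : ℝ)) :=
          mul_le_mul h1 h2 (by positivity) (by positivity)
      _ ≤ ((e : ℝ) + 3) ^ d * ((1 / 2 : ℝ) ^ e * p ^ (-2 : ℝ)) := by gcongr
      _ = _ := by ring
  have hsum2 : Summable fun e : ℕ ↦ b (e + 2) * p ^ (-s * ((e + 2 : ℕ) : ℝ)) :=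
    Summable.of_nonneg_of_le (fun e ↦ mul_nonneg (hb0 _) (by positivity)) hterm
      ((summable_add_three_pow_mul_half_pow d).mul_right _)
  have hsum : Summable fun e : ℕ ↦ b e * p ^ (-s * (e : ℝ)) :=
    (summable_nat_add_iff 2).mp hsum2
  set R := ∑' e : ℕ, b (e + 2) * p ^ (-s * ((e + 2 : ℕ) : ℝ)) with hR
  have hR0 : 0 ≤ R := tsum_nonneg fun e ↦ mul_nonneg (hb0 _) (by positivity)
  have hRle : R ≤ C * p ^ (-2 : ℝ) := by
    rw [hC, ← tsum_mul_right]
    exact hsum2.tsum_le_tsum hterm ((summable_add_three_pow_mul_half_pow d).mul_right _)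
  set u := b 1 * p ^ (-s) with hu
  have hu0 : 0 ≤ u := mul_nonneg (hb0 1) (by positivity)
  have hEq : ∑' e : ℕ, b e * p ^ (-s * (e : ℝ)) = 1 + (u + R) := by
    rw [← hsum.sum_add_tsum_nat_add 2, Finset.sum_range_succ, Finset.sum_range_one]
    simp [h0, hu, hR, add_assoc]
  have hule : u ≤ 2 ^ d * p ^ (-1 : ℝ) := by
    have := hb 1
    norm_num at this
    refine mul_le_mul this (Real.rpow_le_rpow_of_exponent_le (by linarith) (by linarith))
      (by positivity) (by positivity)
  have hp21 : p ^ (-2 : ℝ) ≤ p ^ (-1 : ℝ) :=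
    Real.rpow_le_rpow_of_exponent_le (by linarith) (by norm_num)
  have hsq : (p ^ (-1 : ℝ)) ^ 2 = p ^ (-2 : ℝ) := by
    rw [← Real.rpow_natCast, ← Real.rpow_mul hp0.le]; norm_num
  have hx : (u + R) ^ 2 ≤ (2 ^ d + C) ^ 2 * p ^ (-2 : ℝ) := by
    rw [← hsq, ← mul_pow]
    refine pow_le_pow_left₀ (by positivity) ?_ 2
    have := mul_le_mul_of_nonneg_left hp21 hC0
    linarith
  rw [hEq]
  refine ⟨by positivity, (abs_log_one_add_sub_le hu0 hR0).trans ?_⟩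
  linarith

theorem hasLogGrowth_of_multiplicative {a : ℕ → ℕ} {d : ℕ} (h1 : a 1 = 1)
    (hmul : ∀ {m n : ℕ}, m.Coprime n → a (m * n) = a m * a n)
    (hb : ∀ p : ℕ, p.Prime → ∀ e, a (p ^ e) ≤ (e + 1) ^ d) {ρ : ℝ} (hρ : 0 < ρ)
    (hlim : Tendsto (fun s : ℝ ↦ ((s : ℂ) - 1) * LSeries (fun n ↦ (a n : ℂ)) s) (𝓝[>] 1)
      (𝓝 (ρ : ℂ))) :
    HasLogGrowth (fun p ↦ (a p : ℝ)) 1 := by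
  have hM : ∀ p : Nat.Primes, |(a p : ℝ)| ≤ 2 ^ d := fun p ↦ by
    have := hb p p.2 1
    rw [pow_one] at this
    rw [abs_of_nonneg (by positivity)]
    exact_mod_cast this
  refine ⟨⟨_, hM⟩, ?_⟩
  let f : ℝ → ℕ → ℝ := fun s n ↦ if n = 0 then 0 else a n * (n : ℝ) ^ (-s)
  have hterm : ∀ s n, LSeries.term (fun n ↦ (a n : ℂ)) (s : ℝ) n = ((f s n : ℝ) : ℂ) := by
    intro s n
    rcases eq_or_ne n 0 with rfl | hn
    · simp [f]
    · rw [LSeries.term_of_ne_zero hn]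
      simp only [f, if_neg hn]
      push_cast
      rw [Complex.ofReal_cpow (by positivity), div_eq_mul_inv, ← Complex.cpow_neg]
      push_cast; rfl
  have hLS : ∀ s : ℝ, LSeries (fun n ↦ (a n : ℂ)) s = ((∑' n, f s n : ℝ) : ℂ) := by
    intro s
    rw [LSeries, Complex.ofReal_tsum]
    exact tsum_congr fun n ↦ hterm s n
  have hlim' : Tendsto (fun s : ℝ ↦ (s - 1) * ∑' n, f s n) (𝓝[>] 1) (𝓝 ρ) := by
    refine Filter.tendsto_ofReal_iff.mp ?_
    refine hlim.congr fun s ↦ ?_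
    rw [hLS]; push_cast; rfl
  have hlog := (Real.continuousAt_log hρ.ne').tendsto.comp hlim'
  have hlogO : (fun s : ℝ ↦ Real.log ((s - 1) * ∑' n, f s n)) =O[𝓝[>] 1] (fun _ ↦ (1 : ℝ)) :=
    hlog.isBigO_one ℝ
  have hne : ∀ᶠ s in 𝓝[>] (1 : ℝ), 0 < (s - 1) * ∑' n, f s n := hlim'.eventually_const_lt hρ
  set D : ℝ := (2 ^ d + ∑' e : ℕ, ((e : ℝ) + 3) ^ d * (1 / 2 : ℝ) ^ e) ^ 2 +
        ∑' e : ℕ, ((e : ℝ) + 3) ^ d * (1 / 2 : ℝ) ^ e with hD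
  have hdiff : ∀ᶠ s in 𝓝[>] (1 : ℝ),
      ‖(∑' p : Nat.Primes, (a p : ℝ) * (p : ℝ) ^ (-s)) - Real.log (∑' n, f s n)‖ ≤
        (∑' p : Nat.Primes, D * (p : ℝ) ^ (-2 : ℝ)) * ‖(1 : ℝ)‖ := by
    filter_upwards [self_mem_nhdsWithin, hne] with s hs hpos
    have hs : 1 < s := hs
    have hZ : 0 < ∑' n, f s n := pos_of_mul_pos_right hpos (by linarith)
    have hsum : Summable (f s) := by
      by_contra h
      rw [tsum_eq_zero_of_not_summable h] at hZ
      exact lt_irrefl _ hZ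
    have hprod := EulerProduct.eulerProduct_hasProd (f := f s) (by simp [f, h1])
      (fun {m n} hmn ↦ by
        rcases eq_or_ne m 0 with rfl | hm
        · simp [f]
        rcases eq_or_ne n 0 with rfl | hn
        · simp [f]
        simp only [f, hm, hn, mul_eq_zero, or_self, if_false, hmul hmn]
        push_cast
        rw [Real.mul_rpow (by positivity) (by positivity)]
        ring) hsum.norm (by simp [f])
    have hfac : ∀ p : Nat.Primes, ∑' e, f s (p ^ e) =
        ∑' e : ℕ, (a ((p : ℕ) ^ e) : ℝ) * (p : ℝ) ^ (-s * (e : ℝ)) := by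
      intro p
      refine tsum_congr fun e ↦ ?_
      have : ((p : ℕ) ^ e) ≠ 0 := pow_ne_zero _ p.2.ne_zero
      simp only [f, if_neg this]
      rw [Nat.cast_pow, ← Real.rpow_natCast, ← Real.rpow_mul (by positivity), mul_comm (e : ℝ)]
    have key := fun p : Nat.Primes ↦ abs_log_tsum_sub_le (d := d)
      (b := fun e ↦ (a ((p : ℕ) ^ e) : ℝ)) (by simp [h1]) (fun e ↦ by positivity)
      (fun e ↦ by exact_mod_cast hb p p.2 e) (p := (p : ℝ)) (by exact_mod_cast p.2.two_le) hs
    simp only [hfac] at hprod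
    have hlogsum : HasSum (fun p : Nat.Primes ↦ Real.log
        (∑' e : ℕ, (a ((p : ℕ) ^ e) : ℝ) * (p : ℝ) ^ (-s * (e : ℝ)))) (Real.log (∑' n, f s n)) := by
      refine ((Real.continuousAt_log hZ.ne').tendsto.comp hprod).congr fun T ↦ ?_
      exact Real.log_prod fun p _ ↦ (key p).1.ne'
    have hS := summable_primes_of_bounded (Ψ := fun p ↦ (a p : ℝ)) hM hs
    rw [← hlogsum.tsum_eq, ← hS.tsum_sub hlogsum.summable, norm_one, mul_one]
    have hsum2 : Summable fun p : Nat.Primes ↦ D * (p : ℝ) ^ (-2 : ℝ) :=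
      (Nat.Primes.summable_rpow.mpr (by norm_num)).mul_left D
    refine tsum_of_norm_bounded hsum2.hasSum fun p ↦ ?_
    have := (key p).2
    rw [pow_one] at this
    rw [norm_sub_rev]
    exact this
  refine ((IsBigO.of_bound _ hdiff).add hlogO).congr' ?_ .rfl
  filter_upwards [self_mem_nhdsWithin, hne] with s hs hpos
  have hs : 1 < s := hs
  have hZ : 0 < ∑' n, f s n := pos_of_mul_pos_right hpos (by linarith)
  rw [Real.log_mul (by linarith) hZ.ne']
  ring

end LogGrowth

section IdealCount
open NumberField Ideal

variable (K : Type*) [Field K] [NumberField K]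

/-- The number of ideals of norm `n` in the ring of integers of `K`. -/
noncomputable def idealCount (n : ℕ) : ℕ := Nat.card {I : Ideal (𝓞 K) // absNorm I = n}

lemma idealCount_one : idealCount K 1 = 1 := by
  rw [idealCount, Nat.card_eq_one_iff_unique]
  refine ⟨⟨fun I J ↦ Subtype.ext ?_⟩, ⟨⟨⊤, absNorm_top⟩⟩⟩
  rw [absNorm_eq_one_iff.mp I.2, absNorm_eq_one_iff.mp J.2]

variable {K}

omit [NumberField K] in
lemma sup_span_natCast_eq_top {I : Ideal (𝓞 K)} {m n : ℕ} (h : m.Coprime n)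
    (hI : (m : 𝓞 K) ∈ I) : I ⊔ span {(n : 𝓞 K)} = ⊤ := by
  have h1 : IsCoprime (m : 𝓞 K) (n : 𝓞 K) := by
    simpa using (Nat.isCoprime_iff_coprime.mpr h).map (Int.castRingHom (𝓞 K))
  rw [eq_top_iff, ← isCoprime_iff_sup_eq.mp ((isCoprime_span_singleton_iff _ _).mpr h1)]
  exact sup_le_sup_right ((span_singleton_le_iff_mem I).mpr hI) _

omit [NumberField K] in
lemma mul_sup_span_natCast_eq {J J' : Ideal (𝓞 K)} {m n : ℕ} (h : m.Coprime n)
    (hJ : (m : 𝓞 K) ∈ J) (hJ' : (n : 𝓞 K) ∈ J') : J * J' ⊔ span {(m : 𝓞 K)} = J := by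
  refine le_antisymm (sup_le Ideal.mul_le_left ((span_singleton_le_iff_mem J).mpr hJ)) ?_
  calc J = J * (J' ⊔ span {(m : 𝓞 K)}) := by
        rw [sup_span_natCast_eq_top h.symm hJ', mul_top]
    _ ≤ _ := by
        rw [Ideal.mul_sup]
        exact sup_le_sup_left Ideal.mul_le_right _

omit [NumberField K] in
lemma sup_span_natCast_mul_sup_span_natCast {I : Ideal (𝓞 K)} {m n : ℕ} (h : m.Coprime n)
    (hI : ((m * n : ℕ) : 𝓞 K) ∈ I) :
    (I ⊔ span {(m : 𝓞 K)}) * (I ⊔ span {(n : 𝓞 K)}) = I := by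
  refine le_antisymm ?_ ?_
  · rw [Ideal.sup_mul, Ideal.mul_sup, Ideal.mul_sup, span_singleton_mul_span_singleton]
    refine sup_le (sup_le Ideal.mul_le_left Ideal.mul_le_left)
      (sup_le Ideal.mul_le_right ?_)
    rw [span_singleton_le_iff_mem]
    exact_mod_cast hI
  · rw [mul_eq_inf_of_isCoprime]
    · exact le_inf le_sup_left le_sup_left
    · rw [isCoprime_iff_sup_eq, sup_assoc, eq_top_iff,
        ← sup_span_natCast_eq_top (I := span {(m : 𝓞 K)}) h (mem_span_singleton_self _)]
      exact le_sup_of_le_right (sup_le_sup_left le_sup_right _)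

lemma absNorm_sup_span_natCast_coprime (I : Ideal (𝓞 K)) {m n : ℕ} (h : m.Coprime n) :
    (absNorm (I ⊔ span {(m : 𝓞 K)})).Coprime n := by
  refine Nat.Coprime.coprime_dvd_left (absNorm_dvd_absNorm_of_le le_sup_right) ?_
  rw [absNorm_span_natCast]
  exact h.pow_left _

lemma absNorm_sup_span_natCast {I : Ideal (𝓞 K)} {m n : ℕ} (h : m.Coprime n)
    (hm : m ≠ 0) (hn : n ≠ 0) (hI : absNorm I = m * n) :
    absNorm (I ⊔ span {(m : 𝓞 K)}) = m ∧ absNorm (I ⊔ span {(n : 𝓞 K)}) = n := by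
  have hmem : ((m * n : ℕ) : 𝓞 K) ∈ I := hI ▸ absNorm_mem I
  have hprod := congr_arg absNorm (sup_span_natCast_mul_sup_span_natCast h hmem)
  rw [map_mul, hI] at hprod
  have h1 : absNorm (I ⊔ span {(m : 𝓞 K)}) ∣ m :=
    (absNorm_sup_span_natCast_coprime I h).dvd_of_dvd_mul_right (Dvd.intro _ hprod)
  have h2 : absNorm (I ⊔ span {(n : 𝓞 K)}) ∣ n :=
    (absNorm_sup_span_natCast_coprime I h.symm).dvd_of_dvd_mul_left (Dvd.intro_left _ hprod)
  have l1 := Nat.le_of_dvd (Nat.pos_of_ne_zero hm) h1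
  have l2 := Nat.le_of_dvd (Nat.pos_of_ne_zero hn) h2
  constructor <;> nlinarith [Nat.pos_of_ne_zero hm, Nat.pos_of_ne_zero hn]

variable (K) in
lemma idealCount_mul {m n : ℕ} (h : m.Coprime n) :
    idealCount K (m * n) = idealCount K m * idealCount K n := by
  rcases eq_or_ne m 0 with rfl | hm
  · rw [Nat.coprime_zero_left] at h
    rw [h, idealCount_one, mul_one, mul_one]
  rcases eq_or_ne n 0 with rfl | hn
  · rw [Nat.coprime_zero_right] at h
    rw [h, idealCount_one, one_mul, one_mul]
  rw [idealCount, idealCount, idealCount, ← Nat.card_prod]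
  have hmem {I : Ideal (𝓞 K)} {n : ℕ} (hI : absNorm I = n) : (n : 𝓞 K) ∈ I :=
    hI ▸ absNorm_mem I
  exact Nat.card_congr
    { toFun I := (⟨_, (absNorm_sup_span_natCast h hm hn I.2).1⟩,
        ⟨_, (absNorm_sup_span_natCast h hm hn I.2).2⟩)
      invFun J := ⟨J.1.1 * J.2.1, by rw [map_mul, J.1.2, J.2.2]⟩
      left_inv I := Subtype.ext (sup_span_natCast_mul_sup_span_natCast h (hmem I.2))
      right_inv J := Prod.ext
        (Subtype.ext (mul_sup_span_natCast_eq h (hmem J.1.2) (hmem J.2.2)))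
        (Subtype.ext (by
          have := mul_sup_span_natCast_eq h.symm (hmem J.2.2) (hmem J.1.2)
          rwa [mul_comm] at this)) }

omit [NumberField K] in
lemma liesOver_span_natCast_of_mem {p : ℕ} (hp : p.Prime) {Q : Ideal (𝓞 K)} [hQ : Q.IsPrime]
    (h : (p : 𝓞 K) ∈ Q) : Q.LiesOver (span {(p : ℤ)}) := by
  have hmax : (span {(p : ℤ)}).IsMaximal :=
    PrincipalIdealRing.isMaximal_of_irreducible (Nat.prime_iff_prime_int.mp hp).irreducible
  refine ⟨hmax.eq_of_le (IsPrime.under ℤ Q).ne_top ?_⟩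
  rw [span_singleton_le_iff_mem, mem_comap]
  simpa using h

omit [NumberField K] in
lemma natCast_mem_of_liesOver {p : ℕ} {Q : Ideal (𝓞 K)} [hQ : Q.LiesOver (span {(p : ℤ)})] :
    (p : 𝓞 K) ∈ Q := by
  have : (p : ℤ) ∈ Q.under ℤ := hQ.over ▸ mem_span_singleton_self _
  simpa [mem_comap] using this

lemma dvd_absNorm_of_mem {p : ℕ} (hp : p.Prime) {Q : Ideal (𝓞 K)} [hQ : Q.IsPrime]
    (h : (p : 𝓞 K) ∈ Q) : p ∣ absNorm Q := by
  have h1 : absNorm Q ∣ p ^ Module.finrank ℤ (𝓞 K) := by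
    rw [← absNorm_span_natCast]
    exact absNorm_dvd_absNorm_of_le ((span_singleton_le_iff_mem Q).mpr h)
  obtain ⟨i, -, hi⟩ := (Nat.dvd_prime_pow hp).mp h1
  rw [hi]
  refine dvd_pow_self p fun h0 ↦ hQ.ne_top ?_
  rw [← absNorm_eq_one_iff, hi, h0, pow_zero]

lemma card_primesOver_le_finrank {p : ℕ} (hp : p.Prime) :
    Nat.card ((span {(p : ℤ)}).primesOver (𝓞 K)) ≤ Module.finrank ℤ (𝓞 K) := by
  have hprime : (span {(p : ℤ)}).IsPrime :=
    (span_singleton_prime (by exact_mod_cast hp.ne_zero)).mpr (Nat.prime_iff_prime_int.mp hp)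
  have : Fintype ((span {(p : ℤ)}).primesOver (𝓞 K)) :=
    (Algebra.QuasiFinite.finite_primesOver (span {(p : ℤ)})).fintype
  rw [← sum_ramification_inertia_eq_finrank (span {(p : ℤ)}) (𝓞 K), Nat.card_eq_fintype_card,
    ← Finset.card_univ, Finset.card_eq_sum_ones]
  refine Finset.sum_le_sum fun Q _ ↦ ?_
  have := Q.2.1
  exact Nat.one_le_iff_ne_zero.mpr (mul_ne_zero (ramificationIdx_pos _ _).ne' (inertiaDeg_pos _ _).ne')

variable (K) in
lemma idealCount_prime_pow_le {p : ℕ} (hp : p.Prime) (e : ℕ) :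
    idealCount K (p ^ e) ≤ (e + 1) ^ Module.finrank ℤ (𝓞 K) := by
  classical
  have hprime : (span {(p : ℤ)}).IsPrime :=
    (span_singleton_prime (by exact_mod_cast hp.ne_zero)).mpr (Nat.prime_iff_prime_int.mp hp)
  have : Finite ((span {(p : ℤ)}).primesOver (𝓞 K)) :=
    Algebra.QuasiFinite.finite_primesOver (span {(p : ℤ)})
  have hne {I : Ideal (𝓞 K)} (hI : absNorm I = p ^ e) : I ≠ 0 := by
    rintro rfl
    simp [hp.ne_zero, eq_comm] at hI
  have hcount (I : Ideal (𝓞 K)) (hI : absNorm I = p ^ e) (Q : Ideal (𝓞 K)) [Q.IsPrime]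
      (hQ : (p : 𝓞 K) ∈ Q) :
      (UniqueFactorizationMonoid.normalizedFactors I).count Q < e + 1 := by
    have hQ0 : Q ≠ ⊥ := by
      rintro rfl
      simp [hp.ne_zero] at hQ
    by_contra! hlt
    have hdvd : Q ^ (e + 1) ∣ I := by
      rw [pow_dvd_iff_le_emultiplicity,
        UniqueFactorizationMonoid.emultiplicity_eq_count_normalizedFactors
          (prime_of_isPrime hQ0 inferInstance).irreducible (hne hI), normalize_eq]
      exact_mod_cast hlt
    have h1 := (pow_dvd_pow_of_dvd (dvd_absNorm_of_mem hp hQ) (e + 1)).trans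
      (map_pow absNorm Q (e + 1) ▸ map_dvd absNorm hdvd)
    rw [hI] at h1
    exact absurd ((Nat.pow_dvd_pow_iff_le_right hp.one_lt).mp h1) (by lia)
  let F : {I : Ideal (𝓞 K) // absNorm I = p ^ e} →
      ((span {(p : ℤ)}).primesOver (𝓞 K) → Fin (e + 1)) := fun I Q ↦
    ⟨(UniqueFactorizationMonoid.normalizedFactors I.1).count Q.1, by
      have := Q.2.1
      have := Q.2.2
      exact hcount _ I.2 _ natCast_mem_of_liesOver⟩
  have hF : Function.Injective F := by
    intro I J h
    have key {I : Ideal (𝓞 K)} (hI : absNorm I = p ^ e) {Q : Ideal (𝓞 K)}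
        (hQ : Q ∈ UniqueFactorizationMonoid.normalizedFactors I) :
        Q ∈ (span {(p : ℤ)}).primesOver (𝓞 K) := by
      obtain ⟨hQp, hle⟩ := (mem_normalizedFactors_iff (hne hI)).mp hQ
      refine ⟨hQp, liesOver_span_natCast_of_mem hp (hQp.mem_of_pow_mem e ?_)⟩
      have := absNorm_mem I
      rw [hI] at this
      exact_mod_cast hle this
    refine Subtype.ext ?_
    have hf : UniqueFactorizationMonoid.normalizedFactors I.1 =
        UniqueFactorizationMonoid.normalizedFactors J.1 := by
      ext Q
      by_cases hQ : Q ∈ (span {(p : ℤ)}).primesOver (𝓞 K)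
      · exact congr_arg Fin.val (congr_fun h ⟨Q, hQ⟩)
      · rw [Multiset.count_eq_zero_of_notMem fun h ↦ hQ (key I.2 h),
          Multiset.count_eq_zero_of_notMem fun h ↦ hQ (key J.2 h)]
    rw [← Ideal.prod_normalizedFactors_eq_self (hne I.2), hf, Ideal.prod_normalizedFactors_eq_self (hne J.2)]
  refine (Nat.card_le_card_of_injective F hF).trans ?_
  rw [Nat.card_fun, Nat.card_fin]
  exact Nat.pow_le_pow_right (by lia) (card_primesOver_le_finrank hp)

variable (K) in
lemma hasLogGrowth_idealCount : HasLogGrowth (fun p ↦ (idealCount K p : ℝ)) 1 :=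
  hasLogGrowth_of_multiplicative (idealCount_one K) (idealCount_mul K)
    (fun _ hp e ↦ idealCount_prime_pow_le K hp e) (NumberField.dedekindZeta_residue_pos K)
    (NumberField.tendsto_sub_one_mul_dedekindZeta_nhdsGT K)

end IdealCount

section FrobeniusSum
open NumberField Ideal

variable {L : Type*} [Field L] [NumberField L]

/-- `g` acts as the `p`-th power map modulo `Q`. -/
def ActsAsPow (p : ℕ) (Q : Ideal (𝓞 L)) (g : L ≃ₐ[ℚ] L) : Prop :=
  ∀ x : 𝓞 L, g • x - x ^ p ∈ Q

/-- Inertia groups at all primes over `p` are trivial. -/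
def TrivialInertia (L : Type*) [Field L] [NumberField L] (p : ℕ) : Prop :=
  ∀ Q : Ideal (𝓞 L), Q.IsPrime → (p : 𝓞 L) ∈ Q → ∀ g : L ≃ₐ[ℚ] L,
    (∀ x : 𝓞 L, g • x - x ∈ Q) → g = 1

lemma ActsAsPow.unique {p : ℕ} (hp : TrivialInertia L p) {Q : Ideal (𝓞 L)} [hQ : Q.IsPrime]
    (hpQ : (p : 𝓞 L) ∈ Q) {g h : L ≃ₐ[ℚ] L} (hg : ActsAsPow p Q g) (hh : ActsAsPow p Q h) :
    g = h := by
  rw [← mul_inv_eq_one]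
  refine hp Q hQ hpQ _ fun x ↦ ?_
  simpa [mul_smul] using sub_mem (hg (h⁻¹ • x)) (hh (h⁻¹ • x))

omit [NumberField L] in
lemma natCard_int_quotient_under {p : ℕ} (hp : p.Prime) {Q : Ideal (𝓞 L)} [hQ : Q.IsPrime]
    (hpQ : (p : 𝓞 L) ∈ Q) : Nat.card (ℤ ⧸ Q.under ℤ) = p := by
  rw [← (liesOver_span_natCast_of_mem hp hpQ).over, Int.card_ideal_quot]

lemma exists_actsAsPow [IsGalois ℚ L] {p : ℕ} (hp : p.Prime) {Q : Ideal (𝓞 L)} [hQ : Q.IsPrime]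
    (hpQ : (p : 𝓞 L) ∈ Q) : ∃ g : L ≃ₐ[ℚ] L, ActsAsPow p Q g := by
  have hQ0 : Q ≠ ⊥ := by
    rintro rfl
    simp [hp.ne_zero] at hpQ
  have : Finite (𝓞 L ⧸ Q) := Q.finiteQuotientOfFreeOfNeBot hQ0
  obtain ⟨g, hg⟩ := IsArithFrobAt.exists_of_isInvariant ℤ (L ≃ₐ[ℚ] L) Q
  refine ⟨g, fun x ↦ ?_⟩
  have := hg x
  rwa [natCard_int_quotient_under hp hpQ] at this

open Classical in
/-- A choice of Frobenius element at `Q`, a prime above `p`. -/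
noncomputable def frobAt (p : ℕ) (Q : Ideal (𝓞 L)) : L ≃ₐ[ℚ] L :=
  if h : ∃ g, ActsAsPow p Q g then h.choose else 1

lemma actsAsPow_frobAt [IsGalois ℚ L] {p : ℕ} (hp : p.Prime) {Q : Ideal (𝓞 L)} [hQ : Q.IsPrime]
    (hpQ : (p : 𝓞 L) ∈ Q) : ActsAsPow p Q (frobAt p Q) := by
  rw [frobAt, dif_pos (exists_actsAsPow hp hpQ)]
  exact (exists_actsAsPow hp hpQ).choose_spec

section Subgroup

variable [IsGalois ℚ L] (H : Subgroup (L ≃ₐ[ℚ] L))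

/-- The subfield of `L` fixed by `H`. -/
abbrev fixedSubfield : IntermediateField ℚ L := FixedPoints.intermediateField H

instance isGaloisGroup_ringOfIntegers_fixedPoints : IsGaloisGroup H (𝓞 (fixedSubfield H)) (𝓞 L) :=
  IsGaloisGroup.of_isFractionRing H (𝓞 (fixedSubfield H)) (𝓞 L) (fixedSubfield H) L

lemma absNorm_under_eq_of_frobAt_mem {p : ℕ} (hp : p.Prime) {Q : Ideal (𝓞 L)} [hQ : Q.IsPrime]
    (hpQ : (p : 𝓞 L) ∈ Q) (h : frobAt p Q ∈ H) : absNorm (Q.under (𝓞 (fixedSubfield H))) = p := by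
  have hpP : (p : 𝓞 (fixedSubfield H)) ∈ Q.under (𝓞 (fixedSubfield H)) := by
    rw [mem_comap]
    simpa using hpQ
  have hpow (y : 𝓞 (fixedSubfield H)) : y ^ p - y ∈ Q.under (𝓞 (fixedSubfield H)) := by
    have := actsAsPow_frobAt hp hpQ (algebraMap (𝓞 (fixedSubfield H)) (𝓞 L) y)
    have h1 : frobAt p Q • (algebraMap (𝓞 (fixedSubfield H)) (𝓞 L) y) = algebraMap (𝓞 (fixedSubfield H)) (𝓞 L) y :=
      smul_algebraMap (⟨_, h⟩ : H) y
    rw [h1, ← neg_mem_iff, neg_sub] at this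
    rw [mem_comap]
    simpa using this
  have hP0 : Q.under (𝓞 (fixedSubfield H)) ≠ ⊥ := by
    intro h0
    rw [h0] at hpP
    simp [hp.ne_zero] at hpP
  have : Finite (𝓞 (fixedSubfield H) ⧸ Q.under (𝓞 (fixedSubfield H))) := finiteQuotientOfFreeOfNeBot _ hP0
  have : Fintype (𝓞 (fixedSubfield H) ⧸ Q.under (𝓞 (fixedSubfield H))) := Fintype.ofFinite _
  have : (Q.under (𝓞 (fixedSubfield H))).IsMaximal := (IsPrime.under _ Q).isMaximal hP0
  let : Field (𝓞 (fixedSubfield H) ⧸ Q.under (𝓞 (fixedSubfield H))) := Ideal.Quotient.field _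
  refine le_antisymm ?_ (Nat.le_of_dvd (Nat.pos_of_ne_zero (absNorm_eq_zero_iff.not.mpr hP0))
    (dvd_absNorm_of_mem hp hpP))
  rw [absNorm_apply, Submodule.cardQuot_apply, Nat.card_eq_fintype_card, ← Finset.card_univ]
  have hX := FiniteField.X_pow_card_sub_X_ne_zero (𝓞 (fixedSubfield H) ⧸ Q.under (𝓞 (fixedSubfield H))) hp.one_lt
  rw [← FiniteField.X_pow_card_sub_X_natDegree_eq (𝓞 (fixedSubfield H) ⧸ Q.under (𝓞 (fixedSubfield H))) hp.one_lt]
  refine Polynomial.card_le_degree_of_subset_roots fun y _ ↦ ?_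
  obtain ⟨y, rfl⟩ := Ideal.Quotient.mk_surjective y
  rw [Polynomial.mem_roots hX]
  simp only [Polynomial.IsRoot.def, Polynomial.eval_sub, Polynomial.eval_pow, Polynomial.eval_X]
  rw [← map_pow, ← map_sub, Ideal.Quotient.eq_zero_iff_mem]
  exact hpow y

lemma frobAt_mem_of_absNorm_under_eq {p : ℕ} (hp : p.Prime) (hur : TrivialInertia L p)
    {Q : Ideal (𝓞 L)} [hQ : Q.IsPrime]
    (hpQ : (p : 𝓞 L) ∈ Q) (h : absNorm (Q.under (𝓞 (fixedSubfield H))) = p) : frobAt p Q ∈ H := by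
  have hQ0 : Q ≠ ⊥ := by
    rintro rfl
    simp [hp.ne_zero] at hpQ
  have : Finite (𝓞 L ⧸ Q) := Q.finiteQuotientOfFreeOfNeBot hQ0
  obtain ⟨g, hg⟩ := IsArithFrobAt.exists_of_isInvariant (𝓞 (fixedSubfield H)) H Q
  have hg' : ActsAsPow p Q g.1 := fun x ↦ by
    have := hg x
    rwa [← Submodule.cardQuot_apply, ← absNorm_apply, h] at this
  rw [(actsAsPow_frobAt hp hpQ).unique hur hpQ hg']
  exact g.2

/-- The sum of `f (Frob Q)`, weighted by inertia degrees, over the primes `Q` above `p`. -/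
noncomputable def frobSum (f : (L ≃ₐ[ℚ] L) → ℝ) (p : ℕ) : ℝ :=
  ∑ Q ∈ IsDedekindDomain.primesOverFinset (span {(p : ℤ)}) (𝓞 L), Q.inertiaDeg ℤ * f (frobAt p Q)

omit [IsGalois ℚ L] in
lemma mem_primesOverFinset_span_iff {p : ℕ} (hp : p.Prime) {Q : Ideal (𝓞 L)} :
    Q ∈ IsDedekindDomain.primesOverFinset (span {(p : ℤ)}) (𝓞 L) ↔ Q.IsPrime ∧ (p : 𝓞 L) ∈ Q := by
  have hmax : (span {(p : ℤ)}).IsMaximal :=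
    PrincipalIdealRing.isMaximal_of_irreducible (Nat.prime_iff_prime_int.mp hp).irreducible
  rw [IsDedekindDomain.mem_primesOverFinset_iff
    (by simpa using hp.ne_zero : span {(p : ℤ)} ≠ ⊥)]
  exact ⟨fun ⟨h1, h2⟩ ↦ ⟨h1, natCast_mem_of_liesOver⟩,
    fun ⟨h1, h2⟩ ↦ ⟨h1, liesOver_span_natCast_of_mem hp h2⟩⟩

lemma sum_inertiaDeg_of_absNorm_eq {p : ℕ} (hp : p.Prime) (hur : TrivialInertia L p)
    {P : Ideal (𝓞 (fixedSubfield H))} (hP : absNorm P = p) :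
    ∑ Q ∈ IsDedekindDomain.primesOverFinset P (𝓞 L), Q.inertiaDeg ℤ = Nat.card H := by
  have hPprime : P.IsPrime := isPrime_of_irreducible_absNorm (hP ▸ hp)
  have hP0 : P ≠ ⊥ := by
    rintro rfl
    simp [hp.ne_zero, eq_comm] at hP
  have hmax : P.IsMaximal := hPprime.isMaximal hP0
  have hpP : (p : 𝓞 (fixedSubfield H)) ∈ P := hP ▸ absNorm_mem P
  have hPover := liesOver_span_natCast_of_mem hp hpP
  have hdeg : P.inertiaDeg ℤ = 1 := by
    have := pow_inertiaDeg p P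
    rw [hP] at this
    exact Nat.pow_right_injective hp.two_le (this.trans (pow_one p).symm)
  have hcoe := IsDedekindDomain.coe_primesOverFinset hP0 (𝓞 L)
  have hfin : Finite (𝓞 (fixedSubfield H) ⧸ P) := finiteQuotientOfFreeOfNeBot _ hP0
  have : Finite P.ResidueField :=
    Finite.of_surjective _ P.bijective_algebraMap_quotient_residueField.surjective
  have hterm (Q) (hQ : Q ∈ IsDedekindDomain.primesOverFinset P (𝓞 L)) :
      (IsDedekindDomain.primesOverFinset P (𝓞 L)).card * Q.inertiaDeg ℤ = Nat.card H := by
    rw [← Finset.mem_coe, hcoe] at hQ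
    obtain ⟨hQp, hQo⟩ := hQ
    have hpQ : (p : 𝓞 L) ∈ Q := by
      have : (p : 𝓞 (fixedSubfield H)) ∈ Q.under (𝓞 (fixedSubfield H)) := hQo.over ▸ hpP
      simpa [mem_comap] using this
    have hI : Q.inertia H = ⊥ := by
      rw [Subgroup.eq_bot_iff_forall]
      exact fun g hg ↦ Subtype.ext (hur Q hQp hpQ g.1 hg)
    have := ncard_primesOver_mul_card_inertia_mul_finrank (G := H) P Q
    rw [hI, Subgroup.card_bot, mul_one, ← hcoe, Set.ncard_coe_finset] at this
    rw [inertiaDeg_tower (R := ℤ) (q := P) (r := Q), hdeg, one_mul, this]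
  have hne : (IsDedekindDomain.primesOverFinset P (𝓞 L)).card ≠ 0 := by
    obtain ⟨Q, hQ⟩ := (inferInstance : Nonempty (P.primesOver (𝓞 L)))
    rw [← hcoe] at hQ
    exact Finset.card_ne_zero_of_mem hQ
  refine mul_left_cancel₀ hne ?_
  rw [Finset.mul_sum, Finset.sum_congr rfl hterm, Finset.sum_const, smul_eq_mul]

lemma frobSum_indicator {p : ℕ} (hp : p.Prime) (hur : TrivialInertia L p) :
    frobSum (Set.indicator (H : Set (L ≃ₐ[ℚ] L)) 1) p =
      Nat.card H * idealCount (fixedSubfield H) p := by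
  classical
  have hfin : {P : Ideal (𝓞 (fixedSubfield H)) | absNorm P = p}.Finite :=
    finite_setOfPred_absNorm_eq p
  have hcount : idealCount (fixedSubfield H) p = hfin.toFinset.card := by
    rw [← Set.ncard_eq_toFinset_card _ hfin]
    rfl
  have hmaps : ∀ Q ∈ (IsDedekindDomain.primesOverFinset (span {(p : ℤ)}) (𝓞 L)).filter
      (fun Q ↦ frobAt p Q ∈ H), Q.under (𝓞 (fixedSubfield H)) ∈ hfin.toFinset := by
    intro Q hQ
    rw [Finset.mem_filter, mem_primesOverFinset_span_iff hp] at hQ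
    have := hQ.1.1
    rw [Set.Finite.mem_toFinset]
    exact absNorm_under_eq_of_frobAt_mem H hp hQ.1.2 hQ.2
  have hfib : ∀ P ∈ hfin.toFinset,
      ((IsDedekindDomain.primesOverFinset (span {(p : ℤ)}) (𝓞 L)).filter
        (fun Q ↦ frobAt p Q ∈ H)).filter (fun Q ↦ Q.under (𝓞 (fixedSubfield H)) = P) =
      IsDedekindDomain.primesOverFinset P (𝓞 L) := by
    intro P hP
    rw [Set.Finite.mem_toFinset] at hP
    have hP : absNorm P = p := hP
    have hPprime : P.IsPrime := isPrime_of_irreducible_absNorm (hP ▸ hp)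
    have hP0 : P ≠ ⊥ := by
      rintro rfl
      simp [hp.ne_zero, eq_comm] at hP
    have hmax : P.IsMaximal := hPprime.isMaximal hP0
    ext Q
    rw [Finset.mem_filter, Finset.mem_filter, mem_primesOverFinset_span_iff hp,
      IsDedekindDomain.mem_primesOverFinset_iff hP0]
    constructor
    · rintro ⟨⟨⟨h1, -⟩, -⟩, rfl⟩
      exact ⟨h1, ⟨rfl⟩⟩
    · rintro ⟨h1, ⟨rfl⟩⟩
      have hpQ : (p : 𝓞 L) ∈ Q := by
        have : (p : 𝓞 (fixedSubfield H)) ∈ Q.under (𝓞 (fixedSubfield H)) :=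
          hP ▸ absNorm_mem _
        simpa [mem_comap] using this
      exact ⟨⟨⟨h1, hpQ⟩, frobAt_mem_of_absNorm_under_eq H hp hur hpQ hP⟩, rfl⟩
  calc frobSum (Set.indicator (H : Set (L ≃ₐ[ℚ] L)) 1) p
      = ((∑ Q ∈ (IsDedekindDomain.primesOverFinset (span {(p : ℤ)}) (𝓞 L)).filter
          (fun Q ↦ frobAt p Q ∈ H), Q.inertiaDeg ℤ : ℕ) : ℝ) := by
        rw [frobSum, Finset.sum_filter]
        push_cast
        refine Finset.sum_congr rfl fun Q _ ↦ ?_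
        simp [Set.indicator_apply]
    _ = _ := by
        rw [← Finset.sum_fiberwise_of_maps_to hmaps, Finset.sum_congr rfl fun P hP ↦ by
          rw [hfib P hP, sum_inertiaDeg_of_absNorm_eq H hp hur (hfin.mem_toFinset.mp hP)],
          Finset.sum_const, smul_eq_mul, hcount]
        push_cast
        ring

end Subgroup

end FrobeniusSum

section FrobeniusDensity
open NumberField Ideal

variable (L : Type*) [Field L] [NumberField L]

lemma finite_not_trivialInertia [IsGalois ℚ L] : {p : ℕ | p.Prime ∧ ¬ TrivialInertia L p}.Finite := by
  classical
  have hfaith : FaithfulSMul (L ≃ₐ[ℚ] L) (𝓞 L) := IsGaloisGroup.faithful ℤ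
  have hex (g : L ≃ₐ[ℚ] L) : ∃ x : 𝓞 L, g ≠ 1 → g • x - x ≠ 0 := by
    by_contra! h
    refine (h 0).1 (hfaith.eq_of_smul_eq_smul fun x ↦ ?_)
    rw [one_smul, ← sub_eq_zero, (h x).2]
  choose x hx using hex
  set δ : 𝓞 L := ∏ g ∈ Finset.univ.erase (1 : L ≃ₐ[ℚ] L), (g • x g - x g) with hδ
  have hδ0 : δ ≠ 0 := Finset.prod_ne_zero_iff.mpr fun g hg ↦ hx g (Finset.ne_of_mem_erase hg)
  refine (Set.finite_Iic (absNorm (span {δ}))).subset fun p ⟨hp, hur⟩ ↦ ?_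
  simp only [TrivialInertia, not_forall] at hur
  obtain ⟨Q, hQ, hpQ, g, hg, hg1⟩ := hur
  have hδQ : δ ∈ Q := Q.mem_of_dvd
    (Finset.dvd_prod_of_mem _ (Finset.mem_erase.mpr ⟨hg1, Finset.mem_univ g⟩)) (hg (x g))
  refine Nat.le_of_dvd (Nat.pos_of_ne_zero (by simpa [absNorm_eq_zero_iff] using hδ0)) ?_
  exact (dvd_absNorm_of_mem hp hpQ).trans
    (absNorm_dvd_absNorm_of_le ((span_singleton_le_iff_mem Q).mpr hδQ))

variable {L}

lemma hasLogGrowth_frobSum_indicator [IsGalois ℚ L] (H : Subgroup (L ≃ₐ[ℚ] L)) :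
    HasLogGrowth (frobSum (Set.indicator (H : Set (L ≃ₐ[ℚ] L)) 1)) (Nat.card H) := by
  have h := (hasLogGrowth_idealCount (fixedSubfield H)).smul (Nat.card H : ℝ)
  rw [mul_one] at h
  refine h.congr_off_finite (S := {p | ¬ TrivialInertia L p}) ?_ fun p hp ↦ ?_
  · refine Set.Finite.preimage Subtype.val_injective.injOn (finite_not_trivialInertia L) |>.subset ?_
    exact fun p hp ↦ ⟨p.2, hp⟩
  · exact frobSum_indicator H p.2 (not_not.mp hp)

lemma Subgroup.indicator_zpowers_eq_mem_span {G : Type*} [Group G] [Finite G] (C : Subgroup G) :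
    Set.indicator {x | Subgroup.zpowers x = C} (1 : G → ℝ) ∈
      Submodule.span ℝ (Set.range fun H : Subgroup G ↦ Set.indicator (H : Set G) (1 : G → ℝ)) := by
  classical
  have := Fintype.ofFinite (Subgroup G)
  induction C using WellFoundedLT.induction with
  | ind C ih =>
  have key : Set.indicator {x | Subgroup.zpowers x = C} (1 : G → ℝ) =
      Set.indicator (C : Set G) (1 : G → ℝ) -
        ∑ D with D < C, Set.indicator {x | Subgroup.zpowers x = D} (1 : G → ℝ) := by
    ext x
    simp only [Pi.sub_apply, Finset.sum_apply, Set.indicator_apply, Set.mem_ofPred_eq,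
      SetLike.mem_coe, Pi.one_apply, Finset.sum_ite_eq, Finset.mem_filter, Finset.mem_univ,
      true_and]
    have h1 : x ∈ C ↔ Subgroup.zpowers x ≤ C := Subgroup.zpowers_le.symm
    rw [h1, le_iff_lt_or_eq]
    by_cases h2 : Subgroup.zpowers x = C
    · simp [h2]
    · simp [h2]
  rw [key]
  exact sub_mem (Submodule.subset_span ⟨C, rfl⟩)
    (Submodule.sum_mem _ fun D hD ↦ ih D (Finset.mem_filter.mp hD).2)

lemma hasLogGrowth_frobSum [IsGalois ℚ L] {f : (L ≃ₐ[ℚ] L) → ℝ}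
    (hf : f ∈ Submodule.span ℝ (Set.range fun H : Subgroup (L ≃ₐ[ℚ] L) ↦
      Set.indicator (H : Set (L ≃ₐ[ℚ] L)) (1 : (L ≃ₐ[ℚ] L) → ℝ))) :
    HasLogGrowth (frobSum f) (∑ g, f g) := by
  classical
  induction hf using Submodule.span_induction with
  | mem f hf =>
    obtain ⟨H, rfl⟩ := hf
    convert! hasLogGrowth_frobSum_indicator H
    simp [Set.indicator_apply, Fintype.card_subtype]
  | zero =>
    convert! HasLogGrowth.zero using 1
    · ext p
      simp [frobSum]
    · simp
  | add f g _ _ hf hg =>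
    convert! hf.add hg using 1
    · ext p
      simp [frobSum, mul_add, Finset.sum_add_distrib]
    · simp [Finset.sum_add_distrib]
  | smul r f _ hf =>
    convert! hf.smul r using 1
    · ext p
      simp [frobSum, Finset.mul_sum, mul_left_comm]
    · simp [Finset.mul_sum]

/-- A weak form of Frobenius's density theorem. -/
theorem infinite_zpowers_frobAt_eq [IsGalois ℚ L] (σ : L ≃ₐ[ℚ] L) :
    {p : ℕ | p.Prime ∧ ∃ Q : Ideal (𝓞 L), Q.IsPrime ∧ (p : 𝓞 L) ∈ Q ∧
      Subgroup.zpowers (frobAt p Q) = Subgroup.zpowers σ}.Infinite := by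
  classical
  intro hfin
  have h1 := hasLogGrowth_frobSum
    (Subgroup.indicator_zpowers_eq_mem_span (Subgroup.zpowers σ))
  have h0 : HasLogGrowth 0 _ := h1.congr_off_finite
    (hfin.preimage (f := ((↑) : Nat.Primes → ℕ)) Subtype.val_injective.injOn) fun p hp ↦ by
      refine (Finset.sum_eq_zero fun Q hQ ↦ ?_).symm
      rw [mem_primesOverFinset_span_iff p.2] at hQ
      have hQ' : frobAt (p : ℕ) Q ∉ {x | Subgroup.zpowers x = Subgroup.zpowers σ} :=
        fun h ↦ hp ⟨p.2, Q, hQ.1, hQ.2, h⟩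
      rw [Set.indicator_of_notMem hQ', mul_zero]
  refine (Finset.sum_pos' (fun g _ ↦ ?_) ⟨σ, Finset.mem_univ σ, ?_⟩).ne' h0.eq_zero
  · exact Set.indicator_nonneg (fun _ _ ↦ zero_le_one) g
  · have hmem : σ ∈ {x | Subgroup.zpowers x = Subgroup.zpowers σ} := rfl
    rw [Set.indicator_of_mem hmem]
    exact one_pos

end FrobeniusDensity

section Splitting
open NumberField Ideal

lemma splits_Icc_of_pow_injOn {k p t : ℕ} [Fact p.Prime] (hkp : k < p) (ht : p - 1 = k * t)
    (hinj : ∀ m ∈ Finset.Icc 1 k, ∀ n ∈ Finset.Icc 1 k,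
      (m : ZMod p) ^ t = (n : ZMod p) ^ t → m = n) :
    Splits (Set.Icc (1 : ℤ) (k : ℤ)) p := by
  classical
  have hp : p.Prime := Fact.out
  have hk : 0 < k := Nat.pos_of_ne_zero fun h ↦ by
    have := hp.two_le
    rw [h, zero_mul] at ht
    lia
  have ht0 : t ≠ 0 := fun h ↦ by
    have := hp.two_le
    rw [h, mul_zero] at ht
    lia
  have hroot {x : ZMod p} (hx : x ≠ 0) : x ^ t ∈ Polynomial.nthRootsFinset k (1 : ZMod p) := by
    rw [Polynomial.mem_nthRootsFinset hk, ← pow_mul, mul_comm, ← ht, ZMod.pow_card_sub_one_eq_one hx]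
  have hne {m : ℕ} (hm : m ∈ Finset.Icc 1 k) : (m : ZMod p) ≠ 0 := by
    rw [Finset.mem_Icc] at hm
    rw [Ne, ZMod.natCast_eq_zero_iff]
    exact Nat.not_dvd_of_pos_of_lt hm.1 (hm.2.trans_lt hkp)
  have himage : (Finset.Icc 1 k).image (fun m : ℕ ↦ (m : ZMod p) ^ t) =
      Polynomial.nthRootsFinset k (1 : ZMod p) := by
    refine Finset.eq_of_subset_of_card_le ?_ ?_
    · rw [Finset.image_subset_iff]
      exact fun m hm ↦ hroot (hne hm)
    · rw [Finset.card_image_of_injOn fun m hm n hn h ↦ hinj m hm n hn h, Nat.card_Icc,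
        add_tsub_cancel_right, Polynomial.nthRootsFinset_def]
      exact (Multiset.toFinset_card_le _).trans (Polynomial.card_nthRoots k 1)
  have hlift {m : ℤ} (hm : m ∈ Set.Icc (1 : ℤ) k) : ∃ n ∈ Finset.Icc 1 k, m = (n : ℕ) :=
    ⟨m.toNat, by rw [Finset.mem_Icc]; obtain ⟨h1, h2⟩ := hm; lia, by have := hm.1; lia⟩
  refine ⟨{s | s ≠ 0 ∧ s ^ t = 1}, fun g hg ↦ ?_, ?_⟩
  · obtain ⟨m, hm, hmg⟩ := Finset.mem_image.mp (himage ▸ hroot hg)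
    have hm0 := hne hm
    refine ⟨((m : ℤ), g / m), ⟨?_, ⟨div_ne_zero hg hm0, ?_⟩, ?_⟩, ?_⟩
    · have := Finset.mem_Icc.mp hm
      exact ⟨by lia, by lia⟩
    · rw [div_pow, hmg, div_self (pow_ne_zero _ hg)]
    · push_cast
      exact mul_div_cancel₀ _ hm0
    · rintro ⟨m', s⟩ ⟨hm', ⟨hs0, hs⟩, hms⟩
      obtain ⟨n, hn, rfl⟩ := hlift hm'
      simp only [Int.cast_natCast] at hms
      have hmn : n = m := hinj n hn m hm (by rw [hmg, ← hms, mul_pow, hs, mul_one])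
      subst hmn
      rw [← hms, mul_div_cancel_left₀ _ hm0]
  · rintro ⟨m, hm, s, ⟨hs0, -⟩, hms⟩
    obtain ⟨n, hn, rfl⟩ := hlift hm
    rw [Int.cast_natCast] at hms
    exact mul_ne_zero (hne hn) hs0 hms

lemma Ideal.eq_of_pow_eq_pow_of_sub_mem {R : Type*} [CommRing R] [IsDomain R] {Q : Ideal R}
    [hQ : Q.IsPrime] {k : ℕ} (hk : (k : R) ∉ Q) {A B : R} (hB : B ∉ Q) (hAB : A ^ k = B ^ k)
    (h : A - B ∈ Q) : A = B := by
  have h1 : (∑ i ∈ Finset.range k, A ^ i * B ^ (k - 1 - i)) * (A - B) = 0 := by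
    rw [geom_sum₂_mul, hAB, sub_self]
  rcases mul_eq_zero.mp h1 with h2 | h2
  · have h3 := congr_arg (Ideal.Quotient.mk Q) h2
    have h4 : Ideal.Quotient.mk Q A = Ideal.Quotient.mk Q B := Ideal.Quotient.eq.mpr h
    simp only [map_sum, map_mul, map_pow, h4, map_zero] at h3
    rw [Finset.sum_congr rfl fun i hi ↦ by
      rw [← pow_add, show i + (k - 1 - i) = k - 1 by have := Finset.mem_range.mp hi; lia],
      Finset.sum_const, Finset.card_range, nsmul_eq_mul, ← map_natCast (Ideal.Quotient.mk Q),
      ← map_pow, ← map_mul, Ideal.Quotient.eq_zero_iff_mem] at h3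
    rcases hQ.mem_or_mem h3 with h5 | h5
    · exact absurd h5 hk
    · exact absurd (hQ.mem_of_pow_mem _ h5) hB
  · exact sub_eq_zero.mp h2

variable {L : Type*} [Field L] [NumberField L]

omit [NumberField L] in
lemma intCast_mem_iff {p : ℕ} (hp : p.Prime) {Q : Ideal (𝓞 L)} [hQ : Q.IsPrime]
    (hpQ : (p : 𝓞 L) ∈ Q) {n : ℤ} : (n : 𝓞 L) ∈ Q ↔ (p : ℤ) ∣ n := by
  have := (liesOver_span_natCast_of_mem hp hpQ).over
  rw [← mem_span_singleton, this, mem_comap]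
  simp

omit [NumberField L] in
lemma natCast_mem_iff {p : ℕ} (hp : p.Prime) {Q : Ideal (𝓞 L)} [hQ : Q.IsPrime]
    (hpQ : (p : 𝓞 L) ∈ Q) {n : ℕ} : (n : 𝓞 L) ∈ Q ↔ p ∣ n := by
  have := intCast_mem_iff hp hpQ (n := n)
  rwa [Int.cast_natCast, Int.natCast_dvd_natCast] at this

lemma ActsAsPow.smul_eq_self {k p : ℕ} (hp : p.Prime) (hkp : ¬ p ∣ k) {Q : Ideal (𝓞 L)}
    [hQ : Q.IsPrime] (hpQ : (p : 𝓞 L) ∈ Q) {g : L ≃ₐ[ℚ] L} (hg : ActsAsPow p Q g)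
    {ζ : 𝓞 L} (hk : k ≠ 0) (hζ : ζ ^ k = 1) : g • ζ = ζ ^ p := by
  refine Ideal.eq_of_pow_eq_pow_of_sub_mem (Q := Q) (k := k)
    (mt (natCast_mem_iff hp hpQ).mp hkp) ?_ ?_ (hg ζ)
  · intro h
    refine hQ.ne_top ((eq_top_iff_one Q).mpr ?_)
    rw [← hζ]
    exact Q.pow_mem_of_mem (hQ.mem_of_pow_mem _ h) k (Nat.pos_of_ne_zero hk)
  · rw [← smul_pow', hζ, smul_one, pow_right_comm, hζ, one_pow]

/-- If `g` is a Frobenius element at a prime above `p` with `p - 1 = k * t`, then it scales `k`-th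
roots `a` of `m` and `b` of `n` by the same factor only if `m ^ t = n ^ t` in `ZMod p`, and
conversely. -/
lemma ActsAsPow.smul_mul_eq_iff {k p t m n : ℕ} (hp : p.Prime) (hkp : ¬ p ∣ k)
    (ht : p - 1 = k * t) {Q : Ideal (𝓞 L)} [hQ : Q.IsPrime] (hpQ : (p : 𝓞 L) ∈ Q)
    {g : L ≃ₐ[ℚ] L} (hg : ActsAsPow p Q g) {a b : 𝓞 L} (ha : a ^ k = m) (hb : b ^ k = n)
    (hm : ¬ p ∣ m) (hn : ¬ p ∣ n) :
    g • a * b = a * g • b ↔ (m : ZMod p) ^ t = (n : ZMod p) ^ t := by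
  have hab : a * b ∉ Q := by
    intro h
    have h1 : (a * b) ^ k ∈ Q := Q.pow_mem_of_mem h k (Nat.pos_of_ne_zero fun h ↦ hkp (h ▸ dvd_zero p))
    rw [mul_pow, ha, hb] at h1
    rcases hQ.mem_or_mem h1 with h2 | h2
    · exact hm ((natCast_mem_iff hp hpQ).mp h2)
    · exact hn ((natCast_mem_iff hp hpQ).mp h2)
  have hpow {x : 𝓞 L} {l : ℕ} (hx : x ^ k = l) : x ^ p = x * (l : 𝓞 L) ^ t := by
    rw [← hx, ← pow_mul, ← ht, ← pow_succ', Nat.sub_add_cancel hp.one_le]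
  have hsub : (g • a * b - a * g • b) - (a * b) * (((m : ℤ) ^ t - (n : ℤ) ^ t : ℤ) : 𝓞 L) ∈ Q := by
    have := sub_mem (Q.mul_mem_right b (hg a)) (Q.mul_mem_left a (hg b))
    rw [hpow ha, hpow hb] at this
    convert this using 1
    push_cast
    ring
  have hmod : (((m : ℤ) ^ t - (n : ℤ) ^ t : ℤ) : 𝓞 L) ∈ Q ↔
      (m : ZMod p) ^ t = (n : ZMod p) ^ t := by
    rw [intCast_mem_iff hp hpQ, ← ZMod.intCast_zmod_eq_zero_iff_dvd, ← sub_eq_zero (b := _ ^ t)]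
    push_cast
    rfl
  rw [← hmod]
  constructor
  · intro h
    rw [h, sub_self, zero_sub, neg_mem_iff] at hsub
    exact (hQ.mem_or_mem hsub).resolve_left hab
  · intro h
    have h1 : g • a * b - a * g • b ∈ Q := by
      simpa using add_mem hsub (Q.mul_mem_left (a * b) h)
    have hsmul (l : ℕ) : g • (l : 𝓞 L) = l := map_natCast (MulSemiringAction.toRingHom _ (𝓞 L) g) l
    have hB : (a * g • b) ^ k = (a * b) ^ k := by
      rw [mul_pow, mul_pow, ← smul_pow', hb, hsmul]
    refine Ideal.eq_of_pow_eq_pow_of_sub_mem (Q := Q) (k := k)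
      (mt (natCast_mem_iff hp hpQ).mp hkp) ?_ ?_ h1
    · intro h
      have h2 := Q.pow_mem_of_mem h k (Nat.pos_of_ne_zero fun h ↦ hkp (h ▸ dvd_zero p))
      rw [hB] at h2
      exact hab (hQ.mem_of_pow_mem _ h2)
    · rw [hB, mul_pow, mul_pow, ← smul_pow', ha, hsmul]

lemma smul_mul_eq_mul_smul_iff {g : L ≃ₐ[ℚ] L} {a b : 𝓞 L} (hb : b ≠ 0) :
    g • a * b = a * g • b ↔ g ∈ MulAction.stabilizer (L ≃ₐ[ℚ] L) ((a : L) / b) := by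
  have hb' : (b : L) ≠ 0 := by simpa using hb
  have hgb : g (b : L) ≠ 0 := by simpa using hb
  rw [MulAction.mem_stabilizer_iff, AlgEquiv.smul_def, map_div₀, div_eq_div_iff hgb hb',
    RingOfIntegers.ext_iff]
  rfl

theorem splits_Icc_of_zpowers_eq {k p q : ℕ} (hk : 3 ≤ k) (hq : q.Prime) (hqk : q = 2 * k + 1)
    (hp : p.Prime) (hkp : k < p) {ζ : 𝓞 L} (hζ : IsPrimitiveRoot ζ k) {α : ℕ → 𝓞 L}
    (hα : ∀ m ∈ Finset.Icc 1 k, α m ^ k = m) {Q Q' : Ideal (𝓞 L)} [Q.IsPrime] [Q'.IsPrime]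
    (hpQ : (p : 𝓞 L) ∈ Q) (hqQ' : (q : 𝓞 L) ∈ Q') {φ σ : L ≃ₐ[ℚ] L} (hφ : ActsAsPow p Q φ)
    (hσ : ActsAsPow q Q' σ) (hφσ : Subgroup.zpowers φ = Subgroup.zpowers σ) :
    Splits (Set.Icc (1 : ℤ) (k : ℤ)) p := by
  have : Fact p.Prime := ⟨hp⟩
  have hk0 : k ≠ 0 := by lia
  have hndvd {r m : ℕ} (hr : k < r) (hm : m ∈ Finset.Icc 1 k) : ¬ r ∣ m :=
    Nat.not_dvd_of_pos_of_lt (Finset.mem_Icc.mp hm).1 ((Finset.mem_Icc.mp hm).2.trans_lt hr)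
  have hkmem : k ∈ Finset.Icc 1 k := by rw [Finset.mem_Icc]; lia
  have hkq : k < q := by lia
  have hσφ : σ ∈ Subgroup.zpowers φ := hφσ ▸ Subgroup.mem_zpowers σ
  have hφσ' : φ ∈ Subgroup.zpowers σ := hφσ ▸ Subgroup.mem_zpowers φ
  have hσζ : σ ∈ MulAction.stabilizer (L ≃ₐ[ℚ] L) ζ := by
    rw [MulAction.mem_stabilizer_iff, hσ.smul_eq_self hq (hndvd hkq hkmem) hqQ' hk0 hζ.pow_eq_one,
      hqk, pow_succ, pow_mul', hζ.pow_eq_one, one_pow, one_mul]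
  have hφζ : φ • ζ = ζ := Subgroup.zpowers_le.mpr hσζ hφσ'
  have hdvd : k ∣ p - 1 := by
    rw [hφ.smul_eq_self hp (hndvd hkp hkmem) hpQ hk0 hζ.pow_eq_one] at hφζ
    refine hζ.dvd_of_pow_eq_one _ (mul_right_cancel₀ (hζ.ne_zero hk0) ?_)
    rw [← pow_succ, Nat.sub_add_cancel hp.one_le, hφζ, one_mul]
  obtain ⟨t, ht⟩ := hdvd
  refine splits_Icc_of_pow_injOn hkp ht fun m hm n hn hmn ↦ ?_
  have hαn : α n ≠ 0 := by
    intro h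
    have := hα n hn
    rw [h, zero_pow hk0, eq_comm, Nat.cast_eq_zero] at this
    have := (Finset.mem_Icc.mp hn).1
    lia
  rw [← hφ.smul_mul_eq_iff hp (hndvd hkp hkmem) ht hpQ (hα m hm) (hα n hn) (hndvd hkp hm)
    (hndvd hkp hn), smul_mul_eq_mul_smul_iff hαn, ← Subgroup.zpowers_le] at hmn
  have hσmn := hmn hσφ
  rw [← smul_mul_eq_mul_smul_iff hαn, hσ.smul_mul_eq_iff hq (t := 2) (hndvd hkq hkmem) (by lia) hqQ'
    (hα m hm) (hα n hn) (hndvd hkq hm) (hndvd hkq hn)] at hσmn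
  have : Fact q.Prime := ⟨hq⟩
  have hm' := Finset.mem_Icc.mp hm
  have hn' := Finset.mem_Icc.mp hn
  rcases sq_eq_sq_iff_eq_or_eq_neg.mp hσmn with h | h
  · rw [ZMod.natCast_eq_natCast_iff'] at h
    rwa [Nat.mod_eq_of_lt (by lia), Nat.mod_eq_of_lt (by lia)] at h
  · rw [← add_eq_zero_iff_eq_neg, ← Nat.cast_add, ZMod.natCast_eq_zero_iff] at h
    exact absurd (Nat.le_of_dvd (by lia) h) (by lia)

theorem infinite_setOf_splits_Icc [IsGalois ℚ L] {k : ℕ} (hk : 3 ≤ k) (hq : (2 * k + 1).Prime)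
    {ζ : 𝓞 L} (hζ : IsPrimitiveRoot ζ k) {α : ℕ → 𝓞 L}
    (hα : ∀ m ∈ Finset.Icc 1 k, α m ^ k = m) :
    {p : ℕ | p.Prime ∧ Splits (Set.Icc (1 : ℤ) (k : ℤ)) p}.Infinite := by
  have hprime : (span {((2 * k + 1 : ℕ) : ℤ)}).IsPrime :=
    (span_singleton_prime (by exact_mod_cast hq.ne_zero)).mpr (Nat.prime_iff_prime_int.mp hq)
  obtain ⟨Q', hQ', hQ'o⟩ :=
    (inferInstance : Nonempty ((span {((2 * k + 1 : ℕ) : ℤ)}).primesOver (𝓞 L)))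
  have hqQ' : ((2 * k + 1 : ℕ) : 𝓞 L) ∈ Q' := natCast_mem_of_liesOver
  refine ((infinite_zpowers_frobAt_eq (frobAt (2 * k + 1) Q')).sdiff (Set.finite_Iic k)).mono ?_
  rintro p ⟨⟨hp, Q, hQ, hpQ, h⟩, hkp⟩
  exact ⟨hp, splits_Icc_of_zpowers_eq hk hq rfl hp (not_le.mp hkp) hζ hα hpQ hqQ'
    (actsAsPow_frobAt hp hpQ) (actsAsPow_frobAt hq hqQ') h⟩

lemma isSplittingField_ratAlgebra {P : Polynomial ℚ} (K : Type*) [Field K] [CharZero K]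
    [h : Algebra ℚ K] (hK : Polynomial.IsSplittingField ℚ K P) :
    @Polynomial.IsSplittingField ℚ K _ _ DivisionRing.toRatAlgebra P := by
  obtain rfl : h = DivisionRing.toRatAlgebra := Subsingleton.elim _ _
  exact hK

lemma exists_numberField_isSplittingField (P : Polynomial ℚ) :
    ∃ (L : Type) (_ : Field L) (_ : NumberField L), Polynomial.IsSplittingField ℚ L P := by
  have hsplit := isSplittingField_ratAlgebra P.SplittingField
    (Polynomial.IsSplittingField.splittingField P)
  exact ⟨P.SplittingField, inferInstance,
    { to_finiteDimensional := Polynomial.IsSplittingField.finiteDimensional P.SplittingField P },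
    hsplit⟩

lemma exists_eval₂_eq_zero_of_dvd {P f : Polynomial ℚ} [Polynomial.IsSplittingField ℚ L P]
    (hP : P ≠ 0) (hf : f ∣ P) (hdeg : f.degree ≠ 0) : ∃ x : L, f.eval₂ (algebraMap ℚ L) x = 0 := by
  have hs : (f.map (algebraMap ℚ L)).Splits :=
    (Polynomial.IsSplittingField.splits L P).of_dvd (Polynomial.map_ne_zero hP)
      (Polynomial.map_dvd _ hf)
  obtain ⟨x, hx⟩ := hs.exists_eval_eq_zero (by rwa [Polynomial.degree_map])
  exact ⟨x, by rwa [← Polynomial.eval_map]⟩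

lemma exists_isPrimitiveRoot_of_cyclotomic_dvd {P : Polynomial ℚ}
    [Polynomial.IsSplittingField ℚ L P] (hP : P ≠ 0) {k : ℕ} (hk : k ≠ 0)
    (hdvd : Polynomial.cyclotomic k ℚ ∣ P) : ∃ ζ : 𝓞 L, IsPrimitiveRoot ζ k := by
  obtain ⟨z, hz⟩ := exists_eval₂_eq_zero_of_dvd (L := L) hP hdvd
    (Polynomial.degree_cyclotomic_pos k ℚ (Nat.pos_of_ne_zero hk)).ne'
  have hz' : IsPrimitiveRoot z k := by
    have : NeZero (k : L) := ⟨by exact_mod_cast hk⟩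
    rwa [← Polynomial.isRoot_cyclotomic_iff, Polynomial.IsRoot.def,
      ← Polynomial.map_cyclotomic k (algebraMap ℚ L), Polynomial.eval_map]
  exact ⟨⟨z, hz'.isIntegral (Nat.pos_of_ne_zero hk)⟩,
    IsPrimitiveRoot.of_map_of_injective (f := algebraMap (𝓞 L) L) hz'
      RingOfIntegers.coe_injective⟩

lemma exists_pow_eq_natCast_of_X_pow_sub_C_dvd {P : Polynomial ℚ}
    [Polynomial.IsSplittingField ℚ L P] (hP : P ≠ 0) {k m : ℕ} (hk : k ≠ 0)
    (hdvd : Polynomial.X ^ k - Polynomial.C (m : ℚ) ∣ P) : ∃ a : 𝓞 L, a ^ k = m := by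
  obtain ⟨x, hx⟩ := exists_eval₂_eq_zero_of_dvd (L := L) hP hdvd (by
    rw [Polynomial.degree_X_pow_sub_C (Nat.pos_of_ne_zero hk)]
    exact_mod_cast hk)
  have hx' : x ^ k = m := by simpa [sub_eq_zero] using hx
  obtain ⟨a, rfl⟩ : ∃ a : 𝓞 L, algebraMap (𝓞 L) L a = x :=
    ⟨⟨x, IsIntegral.of_pow (Nat.pos_of_ne_zero hk) (hx' ▸ isIntegral_natCast m)⟩, rfl⟩
  exact ⟨a, RingOfIntegers.coe_injective (by rw [map_pow, map_natCast, hx'])⟩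

end Splitting

/-- If `2k + 1` is prime (`k ≥ 3`), then there are infinitely many primes `p`
such that `[1, k]` splits `ℤ_p`. -/
theorem infinitely_many_split_primes_interval
    (k : ℕ) (hk : 3 ≤ k) (hprime : (2 * k + 1).Prime) :
    {p : ℕ | p.Prime ∧ Splits (Set.Icc (1 : ℤ) (k : ℤ)) p}.Infinite := by
  have hk0 : k ≠ 0 := by lia
  set P : Polynomial ℚ := Polynomial.cyclotomic k ℚ *
    ∏ m ∈ Finset.Icc 1 k, (Polynomial.X ^ k - Polynomial.C (m : ℚ)) with hP
  have hP0 : P ≠ 0 := mul_ne_zero (Polynomial.cyclotomic_ne_zero k ℚ)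
    (Finset.prod_ne_zero_iff.mpr fun m _ ↦ Polynomial.X_pow_sub_C_ne_zero (by lia) _)
  obtain ⟨L, _, _, _⟩ := exists_numberField_isSplittingField P
  have : Normal ℚ L := Normal.of_isSplittingField P
  have : IsGalois ℚ L := {}
  obtain ⟨ζ, hζ⟩ := exists_isPrimitiveRoot_of_cyclotomic_dvd (L := L) hP0 hk0 (dvd_mul_right _ _)
  have hex (m : ℕ) : ∃ a : NumberField.RingOfIntegers L, m ∈ Finset.Icc 1 k → a ^ k = m := by
    by_cases hm : m ∈ Finset.Icc 1 k
    · obtain ⟨a, ha⟩ := exists_pow_eq_natCast_of_X_pow_sub_C_dvd (L := L) hP0 hk0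
        ((Finset.dvd_prod_of_mem (fun m : ℕ ↦ Polynomial.X ^ k - Polynomial.C (m : ℚ)) hm).trans
          (dvd_mul_left _ _))
      exact ⟨a, fun _ ↦ ha⟩
    · exact ⟨0, fun h ↦ absurd h hm⟩
  choose α hα using hex
  exact infinite_setOf_splits_Icc hk hprime hζ hα
end

section
/- Let k₁ and k₂ be integers with 1 ≤ k₁ ≤ k₂ and k₁ + k₂ odd. Then [-k₁,k₂]* does not split Z_p for any prime p. -/
/-- The set of integers `[-k₁, k₂]* = {-k₁, …, k₂} \ {0}`. -/
def Iset (k₁ k₂ : ℕ) : Set ℤ := Set.Icc (-(k₁ : ℤ)) (k₂ : ℤ) \ {0}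

/-- An involution of a finite set of odd cardinality has a fixed point. -/
theorem Finset.exists_fixed_of_involution_of_odd_card {α : Type*} (s : Finset α)
    (hs : Odd s.card) (f : ∀ a ∈ s, α) (hf : ∀ a ha, f a ha ∈ s)
    (hinv : ∀ a ha, f (f a ha) (hf a ha) = a) : ∃ a ha, f a ha = a := by
  by_contra! h
  have hsum : ∑ _a ∈ s, (1 : ZMod 2) = 0 :=
    Finset.sum_involution f (fun _ _ => by decide) (fun a ha _ => h a ha) hf hinv
  rw [Finset.sum_const, nsmul_one, ZMod.natCast_eq_zero_iff_even] at hsum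
  exact Nat.not_even_iff_odd.2 hs hsum

/-- If a finite set `M` of odd cardinality splits `ℤ_p` with splitter set `S`, then every
nonzero element of `ℤ_p` is of the form `m ^ 2 * s`. -/
theorem exists_sq_mul_eq_of_odd_card {p : ℕ} [Fact p.Prime] {M : Finset ℤ} {S : Set (ZMod p)}
    (hM : Odd M.card)
    (hS : ∀ g : ZMod p, g ≠ 0 → ∃! ms : ℤ × ZMod p,
      ms.1 ∈ M ∧ ms.2 ∈ S ∧ (ms.1 : ZMod p) * ms.2 = g)
    (hM0 : ∀ m ∈ M, (m : ZMod p) ≠ 0) {g : ZMod p} (hg : g ≠ 0) :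
    ∃ m ∈ M, ∃ s ∈ S, (m : ZMod p) ^ 2 * s = g := by
  have hex : ∀ a ∈ M, ∃ b ∈ M, ∃ s ∈ S, (a : ZMod p) * b * s = g := by
    intro a ha
    obtain ⟨⟨b, s⟩, ⟨hb, hs, h⟩, -⟩ := hS (g / a) (div_ne_zero hg (hM0 a ha))
    refine ⟨b, hb, s, hs, ?_⟩
    rw [mul_assoc, h, mul_div_cancel₀ _ (hM0 a ha)]
  choose f hf t ht hft using hex
  have hinv : ∀ a ha, f (f a ha) (hf a ha) = a := by
    intro a ha
    have hb := hM0 _ (hf a ha)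
    have := (hS (g / f a ha) (div_ne_zero hg hb)).unique
      (y₁ := (f (f a ha) (hf a ha), t (f a ha) (hf a ha))) (y₂ := (a, t a ha))
      ⟨hf _ _, ht _ _, by rw [eq_div_iff hb]; linear_combination hft (f a ha) (hf a ha)⟩
      ⟨ha, ht _ _, by rw [eq_div_iff hb]; linear_combination hft a ha⟩
    exact congrArg Prod.fst this
  obtain ⟨a, ha, h⟩ := M.exists_fixed_of_involution_of_odd_card hM f hf hinv
  refine ⟨a, ha, t a ha, ht a ha, ?_⟩
  have := hft a ha
  rw [h] at this
  rw [sq, this]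

/-- A finite set of odd cardinality containing `1` and `-1` does not split `ℤ_p`. -/
theorem not_splits_of_odd_card {p : ℕ} [Fact p.Prime] {M : Finset ℤ} (hM : Odd M.card)
    (h1 : 1 ∈ M) (hneg : -1 ∈ M) : ¬ Splits (M : Set ℤ) p := by
  rintro ⟨S, hS, hzero⟩
  simp only [Finset.mem_coe] at hS hzero
  push Not at hzero
  obtain ⟨⟨_, s⟩, ⟨-, hs, -⟩, -⟩ := hS 1 one_ne_zero
  have hM0 : ∀ m ∈ M, (m : ZMod p) ≠ 0 := fun m hm h => hzero m hm s hs (by rw [h, zero_mul])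
  have hs0 : s ≠ 0 := fun h => hzero 1 h1 s hs (by rw [h, mul_zero])
  have hF : ∀ g : ZMod p, ∃ y : ZMod p, (g = 0 → y = 0) ∧
      ∀ m ∈ M, ∀ s ∈ S, (m : ZMod p) * s = g → (m : ZMod p) ^ 2 * s = y := by
    intro g
    by_cases hg : g = 0
    · exact ⟨0, fun _ => rfl, fun m hm s hs h => absurd (h.trans hg) (hzero m hm s hs)⟩
    · obtain ⟨⟨m, t⟩, -, huniq⟩ := hS g hg
      refine ⟨(m : ZMod p) ^ 2 * t, fun h => absurd h hg, fun m' hm' s' hs' h => ?_⟩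
      obtain ⟨rfl, rfl⟩ := Prod.mk.inj (huniq (m', s') ⟨hm', hs', h⟩)
      rfl
  choose F hF0 hF using hF
  have hsurj : Function.Surjective F := by
    intro y
    by_cases hy : y = 0
    · exact ⟨0, (hF0 0 rfl).trans hy.symm⟩
    · obtain ⟨m, hm, t, ht, h⟩ := exists_sq_mul_eq_of_odd_card hM hS hM0 hy
      exact ⟨m * t, (hF _ m hm t ht rfl).symm.trans h⟩
  have hinj : Function.Injective F := Finite.injective_iff_surjective.2 hsurj
  have hneg_eq : -s = s := by
    apply hinj
    rw [← hF (-s) (-1) hneg s hs (by simp), ← hF s 1 h1 s hs (by simp)]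
    simp
  have := (hS s hs0).unique (y₁ := (1, s)) (y₂ := (-1, s)) ⟨h1, hs, by simp⟩
    ⟨hneg, hs, by simpa using hneg_eq⟩
  simp at this

/-- If `1 ≤ k₁ ≤ k₂` and `k₁ + k₂` is odd, then `[-k₁,k₂]*` does not split
`ℤ_p` for any prime `p`. -/
theorem not_splits_of_odd_sum (k₁ k₂ : ℕ) (h1 : 1 ≤ k₁) (h12 : k₁ ≤ k₂)
    (hodd : Odd (k₁ + k₂)) :
    ∀ p : ℕ, p.Prime → ¬ Splits (Iset k₁ k₂) p := by
  intro p hp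
  have : Fact p.Prime := ⟨hp⟩
  have hset : Iset k₁ k₂ = ((Finset.Icc (-(k₁ : ℤ)) k₂).erase 0 : Finset ℤ) := by
    simp [Iset]
  rw [hset]
  apply not_splits_of_odd_card
  · rw [Finset.card_erase_of_mem (by simp), Int.card_Icc]
    convert hodd using 1
    omega
  · simp only [Finset.mem_erase, Finset.mem_Icc]
    omega
  · simp only [Finset.mem_erase, Finset.mem_Icc]
    omega
end
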